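/- The 5×7 zero-one weighing scheme with rows (0,0,0,0,1,1,1), (0,0,1,1,1,0,1), (1,1,1,0,0,1,1), (1,0,0,1,1,1,0), (0,1,1,1,1,1,0) is valid for 7 mints with 5 weighings, and its cost is 7. Hence C(5,7) = 7. -/

import Mathlib

/-- Excess-weight vector of state `d` under scheme `C`. -/
def vvec {W M : ℕ} (C : Fin W → Fin M → ℕ) (d : Fin M → Bool) : Fin W → ℕ :=
  fun w => ∑ m, C w m * (if d m then 1 else 0)

/-- A scheme is valid when excess vectors of distinct states are never
positive rational multiples of each other. -/
def ValidScheme {W M : ℕ} (C : Fin W → Fin M → ℕ) : Prop :=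
  ∀ d d' : Fin M → Bool, d ≠ d' →
    ¬ ∃ q : ℚ, 0 < q ∧
      (fun w => (vvec C d' w : ℚ)) = q • (fun w => (vvec C d w : ℚ))

/-- Total number of coins needed: each mint supplies its column maximum. -/
def cost {W M : ℕ} (C : Fin W → Fin M → ℕ) : ℕ :=
  ∑ m, Finset.univ.sup fun w => C w m

/-- Boolean conjunction over both truth values. -/
def bothB (p : Bool → Bool) : Bool := p true && p false

theorem bothB_spec {p : Bool → Bool} (h : bothB p = true) (b : Bool) : p b = true := by
  unfold bothB at h
  cases b <;> simp_all

/-- Cross-multiplication test (`true` when the two pairs are proportional). -/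
def crossB (x y xx yy : ℕ) : Bool := Nat.beq (xx * y) (yy * x)

/-- Both entries vanish or neither does. -/
def zeroB (x xx : ℕ) : Bool := (Nat.beq x 0) == (Nat.beq xx 0)

/-- Necessary conditions for two weight vectors to be positive multiples of each other. -/
def propB (x0 x1 x2 x3 x4 y0 y1 y2 y3 y4 : ℕ) : Bool :=
  zeroB x0 y0 && zeroB x1 y1 && zeroB x2 y2 && zeroB x3 y3 && zeroB x4 y4 &&
  crossB x0 x1 y0 y1 && crossB x0 x2 y0 y2 && crossB x0 x3 y0 y3 && crossB x0 x4 y0 y4 &&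
  crossB x1 x2 y1 y2 && crossB x1 x3 y1 y3 && crossB x1 x4 y1 y4 &&
  crossB x2 x3 y2 y3 && crossB x2 x4 y2 y4 && crossB x3 x4 y3 y4

/-- Numerical value of a bit. -/
def bitN (b : Bool) : ℕ := if b then 1 else 0

/-- The test for one pair of states: proportional implies equal. -/
def pairB (a b c d e f g aa bb cc dd ee ff gg : Bool) : Bool :=
  !(propB (bitN e + bitN f + bitN g) (bitN c + bitN d + bitN e + bitN g)
      (bitN a + bitN b + bitN c + bitN f + bitN g) (bitN a + bitN d + bitN e + bitN f)
      (bitN b + bitN c + bitN d + bitN e + bitN f)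
      (bitN ee + bitN ff + bitN gg) (bitN cc + bitN dd + bitN ee + bitN gg)
      (bitN aa + bitN bb + bitN cc + bitN ff + bitN gg) (bitN aa + bitN dd + bitN ee + bitN ff)
      (bitN bb + bitN cc + bitN dd + bitN ee + bitN ff)) ||
  (a == aa && b == bb && c == cc && d == dd && e == ee && f == ff && g == gg)

set_option maxRecDepth 100000 in
theorem all_pairs :
    (bothB fun a => bothB fun b => bothB fun c => bothB fun d => bothB fun e => bothB fun f =>
      bothB fun g => bothB fun aa => bothB fun bb => bothB fun cc => bothB fun dd =>
      bothB fun ee => bothB fun ff => bothB fun gg =>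
        pairB a b c d e f g aa bb cc dd ee ff gg) = true := by
  decide +kernel

theorem pair_spec (a b c d e f g aa bb cc dd ee ff gg : Bool) :
    pairB a b c d e f g aa bb cc dd ee ff gg = true :=
  bothB_spec (bothB_spec (bothB_spec (bothB_spec (bothB_spec (bothB_spec (bothB_spec
    (bothB_spec (bothB_spec (bothB_spec (bothB_spec (bothB_spec (bothB_spec (bothB_spec
      all_pairs a) b) c) d) e) f) g) aa) bb) cc) dd) ee) ff) gg

theorem crossB_of {q : ℚ} {x y xx yy : ℕ} (hx : (xx : ℚ) = q * x) (hy : (yy : ℚ) = q * y) :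
    crossB x y xx yy = true := by
  unfold crossB
  rw [Nat.beq_eq]
  have : (xx : ℚ) * y = yy * x := by rw [hx, hy]; ring
  exact_mod_cast this

theorem zeroB_of {q : ℚ} (hq : 0 < q) {x xx : ℕ} (hx : (xx : ℚ) = q * x) :
    zeroB x xx = true := by
  have h : xx = 0 ↔ x = 0 := by
    have : (xx : ℚ) = 0 ↔ (x : ℚ) = 0 := by
      rw [hx, mul_eq_zero]
      exact ⟨fun h => h.resolve_left hq.ne', Or.inr⟩
    exact_mod_cast this
  unfold zeroB
  rw [beq_iff_eq, Bool.eq_iff_iff, Nat.beq_eq, Nat.beq_eq, h]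

theorem propB_of {q : ℚ} (hq : 0 < q) {x0 x1 x2 x3 x4 y0 y1 y2 y3 y4 : ℕ}
    (h0 : (y0 : ℚ) = q * x0) (h1 : (y1 : ℚ) = q * x1) (h2 : (y2 : ℚ) = q * x2)
    (h3 : (y3 : ℚ) = q * x3) (h4 : (y4 : ℚ) = q * x4) :
    propB x0 x1 x2 x3 x4 y0 y1 y2 y3 y4 = true := by
  simp only [propB, zeroB_of hq h0, zeroB_of hq h1, zeroB_of hq h2, zeroB_of hq h3,
    zeroB_of hq h4, crossB_of h0 h1, crossB_of h0 h2, crossB_of h0 h3, crossB_of h0 h4,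
    crossB_of h1 h2, crossB_of h1 h3, crossB_of h1 h4, crossB_of h2 h3, crossB_of h2 h4,
    crossB_of h3 h4, Bool.and_self]

/-- Every column of a valid scheme has a nonzero entry. -/
theorem col_pos {W M : ℕ} (C : Fin W → Fin M → ℕ) (hC : ValidScheme C) (m : Fin M) :
    1 ≤ Finset.univ.sup fun w => C w m := by
  by_contra hlt
  have h0 : (Finset.univ.sup fun w => C w m) = 0 := by omega
  have hz : ∀ w, C w m = 0 := fun w => by
    have := Finset.le_sup (f := fun w => C w m) (Finset.mem_univ w)
    simp only [h0] at this
    omega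
  refine hC (fun _ => false) (fun k => decide (k = m)) ?_ ⟨1, one_pos, ?_⟩
  · intro h
    simpa using congrFun h m
  · funext w
    simp [vvec, hz]

theorem stmt_12 :
    ValidScheme ![![0, 0, 0, 0, 1, 1, 1], ![0, 0, 1, 1, 1, 0, 1], ![1, 1, 1, 0, 0, 1, 1],
        ![1, 0, 0, 1, 1, 1, 0], ![0, 1, 1, 1, 1, 1, 0]] ∧
    cost ![![0, 0, 0, 0, 1, 1, 1], ![0, 0, 1, 1, 1, 0, 1], ![1, 1, 1, 0, 0, 1, 1],
        ![1, 0, 0, 1, 1, 1, 0], ![0, 1, 1, 1, 1, 1, 0]] = 7 ∧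
    (∀ C : Fin 5 → Fin 7 → ℕ, ValidScheme C → 7 ≤ cost C) := by
  refine ⟨?_, ?_, ?_⟩
  · rintro d dd hne ⟨q, hq, h⟩
    apply hne
    have h0 := congrFun h 0
    have h1 := congrFun h 1
    have h2 := congrFun h 2
    have h3 := congrFun h 3
    have h4 := congrFun h 4
    simp only [Pi.smul_apply, smul_eq_mul] at h0 h1 h2 h3 h4
    have hp := propB_of hq h0 h1 h2 h3 h4
    have hs := pair_spec (d 0) (d 1) (d 2) (d 3) (d 4) (d 5) (d 6)
      (dd 0) (dd 1) (dd 2) (dd 3) (dd 4) (dd 5) (dd 6)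
    unfold pairB at hs
    simp [vvec, Fin.sum_univ_seven] at hp
    simp only [bitN] at hs
    simp [hp] at hs
    funext i
    fin_cases i <;> simp [hs]
  · decide
  · intro C hC
    calc 7 = ∑ _m : Fin 7, 1 := by simp
      _ ≤ cost C := Finset.sum_le_sum fun m _ => col_pos C hC m
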